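/- For any finite set Y ⊆ 𝒳 with |Y| ≥ 6, there is no majoritarian voting method with domain {P : X(P) ⊆ Y} satisfying anonymity, neutrality, binary quasi-resoluteness, binary γ, and α-resoluteness. -/

import Mathlib

/- Formalization of voting-theoretic notions from Holliday, Norman, Pacuit, Zahedian,
"Impossibility theorems involving weakenings of expansion consistency and resoluteness
in voting". Candidates form an infinite type `C` and voters an infinite type `V`. -/

open Classical

noncomputable section

/-- `L` is a strict linear order on exactly the finite set `s`. -/
def IsStrictLinearOrderOn {C : Type} (s : Finset C) (L : C → C → Prop) : Prop :=
  (∀ x, ¬ L x x) ∧ (∀ x y z, L x y → L y z → L x z) ∧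
    (∀ x ∈ s, ∀ y ∈ s, x ≠ y → L x y ∨ L y x) ∧ ∀ x y, L x y → x ∈ s ∧ y ∈ s

/-- Restriction of a relation to a finite set `A`. -/
def restrictRel {C : Type} (A : Finset C) (L : C → C → Prop) : C → C → Prop :=
  fun x y => L x y ∧ x ∈ A ∧ y ∈ A

theorem IsStrictLinearOrderOn.restrict {C : Type} {s A : Finset C} {L : C → C → Prop}
    (h : IsStrictLinearOrderOn s L) (hA : A ⊆ s) :
    IsStrictLinearOrderOn A (restrictRel A L) := by
  obtain ⟨hirr, htr, htot, hdom⟩ := h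
  refine ⟨fun x hx => hirr x hx.1,
    fun x y z hxy hyz => ⟨htr _ _ _ hxy.1 hyz.1, hxy.2.1, hyz.2.2⟩, ?_,
    fun x y hxy => ⟨hxy.2.1, hxy.2.2⟩⟩
  intro x hx y hy hne
  rcases htot x (hA hx) y (hA hy) hne with h' | h'
  · exact Or.inl ⟨h', hx, hy⟩
  · exact Or.inr ⟨h', hy, hx⟩

/-- The image of a relation under the transposition of `a` and `b`. -/
def swapRel {C : Type} (a b : C) (L : C → C → Prop) : C → C → Prop :=
  fun x y => L (Equiv.swap a b x) (Equiv.swap a b y)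

theorem IsStrictLinearOrderOn.swapRel_mem {C : Type} {s : Finset C} {L : C → C → Prop}
    (a b : C) (h : IsStrictLinearOrderOn s L) :
    IsStrictLinearOrderOn (s.image (Equiv.swap a b)) (swapRel a b L) := by
  obtain ⟨hirr, htr, htot, hdom⟩ := h
  refine ⟨fun x => hirr _, fun x y z hxy hyz => htr _ _ _ hxy hyz, ?_, ?_⟩
  · intro x hx y hy hne
    obtain ⟨x', hx', rfl⟩ := Finset.mem_image.mp hx
    obtain ⟨y', hy', rfl⟩ := Finset.mem_image.mp hy
    have hne' : x' ≠ y' := by rintro rfl; exact hne rfl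
    have := htot x' hx' y' hy' hne'
    simpa [swapRel, Equiv.swap_apply_self] using this
  · intro x y hxy
    obtain ⟨h1, h2⟩ := hdom _ _ hxy
    exact ⟨Finset.mem_image.mpr ⟨_, h1, Equiv.swap_apply_self a b x⟩,
      Finset.mem_image.mpr ⟨_, h2, Equiv.swap_apply_self a b y⟩⟩

/-- A preference profile: each voter in the finite set `voters` submits a strict linear
order of the finite nonempty set `cands` of candidates. -/
structure Profile (C V : Type) where
  voters : Finset V
  cands : Finset C
  cands_nonempty : cands.Nonempty
  ballot : V → C → C → Prop
  ballot_lin : ∀ i ∈ voters, IsStrictLinearOrderOn cands (ballot i)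

namespace Profile

variable {C V : Type}

/-- The margin of `x` over `y` in `P`: the number of voters ranking `x` above `y`
minus the number of voters ranking `y` above `x`. -/
def margin (P : Profile C V) (x y : C) : ℤ :=
  ((P.voters.filter (fun i => P.ballot i x y)).card : ℤ) -
    ((P.voters.filter (fun i => P.ballot i y x)).card : ℤ)

/-- The profile `P^{i⇄j}` obtained by transposing the voters `i` and `j`. -/
def swapVoters (P : Profile C V) (i j : V) : Profile C V where
  voters := P.voters.image (Equiv.swap i j)
  cands := P.cands
  cands_nonempty := P.cands_nonempty
  ballot := fun k => P.ballot (Equiv.swap i j k)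
  ballot_lin := by
    intro k hk
    obtain ⟨m, hm, rfl⟩ := Finset.mem_image.mp hk
    simpa [Equiv.swap_apply_self] using P.ballot_lin m hm

/-- The profile `P_{a⇄b}` obtained by transposing the candidates `a` and `b`. -/
def swapCands (P : Profile C V) (a b : C) : Profile C V where
  voters := P.voters
  cands := P.cands.image (Equiv.swap a b)
  cands_nonempty := P.cands_nonempty.image _
  ballot := fun i => swapRel a b (P.ballot i)
  ballot_lin := fun i hi => (P.ballot_lin i hi).swapRel_mem a b

/-- The restriction `P|_A` of a profile to a nonempty subset `A` of its candidates. -/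
def restrict (P : Profile C V) (A : Finset C) (hA : A.Nonempty) (hsub : A ⊆ P.cands) :
    Profile C V where
  voters := P.voters
  cands := A
  cands_nonempty := hA
  ballot := fun i => restrictRel A (P.ballot i)
  ballot_lin := fun i hi => (P.ballot_lin i hi).restrict hsub

/-- The profile `P_{-y}`, i.e. `P` with the candidate `y` removed. -/
def minus (P : Profile C V) (y : C) (h : (P.cands.erase y).Nonempty) : Profile C V :=
  P.restrict (P.cands.erase y) h (P.cands.erase_subset y)

/-- The profile `P|_{{x,y}}`, i.e. `P` restricted to the two candidates `x` and `y`. -/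
def pair (P : Profile C V) (x y : C) (hx : x ∈ P.cands) (hy : y ∈ P.cands) : Profile C V :=
  P.restrict {x, y} ⟨x, Finset.mem_insert_self x {y}⟩
    (by
      intro z hz
      rcases Finset.mem_insert.mp hz with rfl | hz
      · exact hx
      · rcases Finset.mem_singleton.mp hz with rfl
        exact hy)

/-- `P` is uniquely weighted: no two distinct ordered pairs of distinct candidates
have the same margin. -/
def UniquelyWeighted (P : Profile C V) : Prop :=
  ∀ a ∈ P.cands, ∀ b ∈ P.cands, ∀ x ∈ P.cands, ∀ y ∈ P.cands,
    a ≠ b → x ≠ y → (a, b) ≠ (x, y) → P.margin a b ≠ P.margin x y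

/-- `P` is uniquely ranked: in every subelection with at least two candidates, no two
candidates have the same number of `n`-th place votes, and no two candidates have the
same Borda score. -/
def UniquelyRanked (P : Profile C V) : Prop :=
  ∀ Y ⊆ P.cands, 2 ≤ Y.card →
    ((∀ n : ℕ, 1 ≤ n → n ≤ Y.card → ∀ x ∈ Y, ∀ y ∈ Y, x ≠ y →
        (P.voters.filter
            (fun i => (Y.filter (fun z => P.ballot i z x)).card = n - 1)).card ≠
          (P.voters.filter
            (fun i => (Y.filter (fun z => P.ballot i z y)).card = n - 1)).card) ∧
      (∀ x ∈ Y, ∀ y ∈ Y, x ≠ y →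
        (∑ i ∈ P.voters, (Y.filter (fun z => P.ballot i x z)).card) ≠
          ∑ i ∈ P.voters, (Y.filter (fun z => P.ballot i y z)).card))

/-- `Q` is an `n`-fold copy `nP` of `P`: same candidates, and there is a map sending
the voters of `Q` onto the voters of `P` such that each voter of `P` has exactly `n`
preimages, each with the same ballot. -/
def IsCopy (Q P : Profile C V) (n : ℕ) : Prop :=
  Q.cands = P.cands ∧
    ∃ h : V → V,
      (∀ j ∈ Q.voters, h j ∈ P.voters) ∧
      (∀ i ∈ P.voters, (Q.voters.filter (fun j => h j = i)).card = n) ∧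
      (∀ j ∈ Q.voters, Q.ballot j = P.ballot (h j))

/-- `Q` is obtained from `P` by deleting one voter with each linear order of the
candidates of `P`. -/
def IsCancelOf (Q P : Profile C V) : Prop :=
  Q.cands = P.cands ∧ Q.voters ⊆ P.voters ∧
    (∀ j ∈ Q.voters, Q.ballot j = P.ballot j) ∧
    ∀ L : C → C → Prop, IsStrictLinearOrderOn P.cands L →
      ((P.voters \ Q.voters).filter (fun i => P.ballot i = L)).card = 1

end Profile

/-- A voting method: a function assigning to each profile in a nonempty domain a
nonempty set of winners among its candidates. -/
structure VotingMethod (C V : Type) where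
  dom : Set (Profile C V)
  dom_nonempty : dom.Nonempty
  winners : Profile C V → Finset C
  winners_nonempty : ∀ P ∈ dom, (winners P).Nonempty
  winners_sub : ∀ P ∈ dom, winners P ⊆ P.cands

namespace VotingMethod

variable {C V : Type}

/-- Anonymity: transposing two voters does not change the winners. -/
def Anonymous (F : VotingMethod C V) : Prop :=
  ∀ P ∈ F.dom, ∀ i j : V, P.swapVoters i j ∈ F.dom →
    F.winners (P.swapVoters i j) = F.winners P

/-- Neutrality: transposing two candidates transposes the winners accordingly. -/
def Neutral (F : VotingMethod C V) : Prop :=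
  ∀ P ∈ F.dom, ∀ a b : C, P.swapCands a b ∈ F.dom →
    F.winners (P.swapCands a b) = (F.winners P).image (Equiv.swap a b)

/-- Binary resoluteness: a unique winner in any two-candidate profile. -/
def BinaryResolute (F : VotingMethod C V) : Prop :=
  ∀ P ∈ F.dom, P.cands.card = 2 → (F.winners P).card = 1

/-- Binary quasi-resoluteness: a unique winner in any two-candidate profile whose
two distinct candidates have a nonzero margin between them. -/
def BinaryQuasiResolute (F : VotingMethod C V) : Prop :=
  ∀ P ∈ F.dom, P.cands.card = 2 →
    (∀ x ∈ P.cands, ∀ y ∈ P.cands, x ≠ y → P.margin x y ≠ 0) →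
    (F.winners P).card = 1

/-- Quasi-resoluteness: a unique winner in any uniquely weighted profile. -/
def QuasiResolute (F : VotingMethod C V) : Prop :=
  ∀ P ∈ F.dom, P.UniquelyWeighted → (F.winners P).card = 1

/-- Weak quasi-resoluteness: a unique winner in any profile that is both uniquely
weighted and uniquely ranked. -/
def WeakQuasiResolute (F : VotingMethod C V) : Prop :=
  ∀ P ∈ F.dom, P.UniquelyWeighted → P.UniquelyRanked → (F.winners P).card = 1

/-- Binary γ: if `x` wins without `y` and wins the head-to-head against `y`,
then `x` wins with `y` included. -/
def BinaryGamma (F : VotingMethod C V) : Prop :=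
  ∀ P ∈ F.dom, ∀ x, ∀ hx : x ∈ P.cands, ∀ y, ∀ hy : y ∈ P.cands, x ≠ y →
    ∀ h : (P.cands.erase y).Nonempty,
      P.minus y h ∈ F.dom → P.pair x y hx hy ∈ F.dom →
      x ∈ F.winners (P.minus y h) → F.winners (P.pair x y hx hy) = {x} →
      x ∈ F.winners P

/-- α-resoluteness: if `x` wins without `y` and wins the head-to-head against `y`,
then adding `y` does not enlarge the set of winners. -/
def AlphaResolute (F : VotingMethod C V) : Prop :=
  ∀ P ∈ F.dom, ∀ x, ∀ hx : x ∈ P.cands, ∀ y, ∀ hy : y ∈ P.cands, x ≠ y →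
    ∀ h : (P.cands.erase y).Nonempty,
      P.minus y h ∈ F.dom → P.pair x y hx hy ∈ F.dom →
      x ∈ F.winners (P.minus y h) → F.winners (P.pair x y hx hy) = {x} →
      (F.winners P).card ≤ (F.winners (P.minus y h)).card

/-- Homogeneity: replacing each voter by `n` copies of that voter does not change
the winners. -/
def Homogeneous (F : VotingMethod C V) : Prop :=
  ∀ P ∈ F.dom, ∀ Q ∈ F.dom, ∀ n : ℕ, 0 < n → Q.IsCopy P n → F.winners Q = F.winners P

/-- Cancellativity: deleting one voter with each linear order of the candidates does
not change the winners. -/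
def Cancellative (F : VotingMethod C V) : Prop :=
  ∀ P ∈ F.dom, ∀ Q ∈ F.dom, Q.IsCancelOf P → F.winners Q = F.winners P

/-- Majoritarianism: the winners depend only on the majority graph of the profile. -/
def Majoritarian (F : VotingMethod C V) : Prop :=
  ∀ P ∈ F.dom, ∀ P' ∈ F.dom, P.cands = P'.cands →
    (∀ x ∈ P.cands, ∀ y ∈ P.cands, (0 < P.margin x y ↔ 0 < P'.margin x y)) →
    F.winners P = F.winners P'

/-- Pairwiseness: the winners depend only on the margin graph of the profile. -/
def Pairwise (F : VotingMethod C V) : Prop :=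
  ∀ P ∈ F.dom, ∀ P' ∈ F.dom, P.cands = P'.cands →
    (∀ x ∈ P.cands, ∀ y ∈ P.cands, P.margin x y = P'.margin x y) →
    F.winners P = F.winners P'

end VotingMethod

namespace NM

variable {C V : Type}

/-- `x` beats `y` in the majority relation (`b = true`) or its reverse (`b = false`). -/
def Beats (b : Bool) (P : Profile C V) (x y : C) : Prop :=
  if b then 0 < P.margin x y else 0 < P.margin y x

theorem margin_restrict (P : Profile C V) (A : Finset C) (hA : A.Nonempty) (hs : A ⊆ P.cands)
    {x y : C} (hx : x ∈ A) (hy : y ∈ A) : (P.restrict A hA hs).margin x y = P.margin x y := by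
  simp [Profile.margin, Profile.restrict, restrictRel, hx, hy]

theorem margin_swap (P : Profile C V) (a b x y : C) :
    (P.swapCands a b).margin x y = P.margin (Equiv.swap a b x) (Equiv.swap a b y) := by
  rfl

theorem beats_restrict (b : Bool) (P : Profile C V) (A : Finset C) (hA : A.Nonempty)
    (hs : A ⊆ P.cands) {x y : C} (hx : x ∈ A) (hy : y ∈ A) :
    Beats b (P.restrict A hA hs) x y ↔ Beats b P x y := by
  simp [Beats, margin_restrict, hx, hy]

theorem beats_swap (b : Bool) (P : Profile C V) (u v x y : C) :
    Beats b (P.swapCands u v) x y ↔ Beats b P (Equiv.swap u v x) (Equiv.swap u v y) := by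
  simp [Beats, margin_swap]

/-- `P` realizes the pattern `t` via the labelling `g`. -/
structure Rlz (Y : Finset C) (b : Bool) (n : ℕ) (P : Profile C V) (g : Fin n → C)
    (t : Fin n → Fin n → Bool) : Prop where
  inj : Function.Injective g
  cands : P.cands = Finset.univ.image g
  sub : P.cands ⊆ Y
  maj : ∀ i j, Beats b P (g i) (g j) ↔ t i j = true

theorem inv_aux {Y : Finset C} {F : VotingMethod C V}
    (hd : F.dom = {P : Profile C V | P.cands ⊆ Y}) (hM : F.Majoritarian) (hN : F.Neutral)
    (b : Bool) {n : ℕ} {t : Fin n → Fin n → Bool} {P' : Profile C V} {g' : Fin n → C}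
    (h' : Rlz Y b n P' g' t) :
    ∀ (k : ℕ) (P : Profile C V) (g : Fin n → C), Rlz Y b n P g t →
      (Finset.univ.filter (fun i => g i ≠ g' i)).card = k →
      ∀ i, g i ∈ F.winners P ↔ g' i ∈ F.winners P' := by
  intro k
  induction k using Nat.strong_induction_on with
  | _ k ih =>
  intro P g h hk
  by_cases hz : ∃ i, g i ≠ g' i
  · obtain ⟨i, hi⟩ := hz
    have hgi : g i ∈ Y := h.sub (by rw [h.cands]; simp)
    have hgi' : g' i ∈ Y := h'.sub (by rw [h'.cands]; simp)
    have hc : (P.swapCands (g i) (g' i)).cands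
        = Finset.univ.image (fun j => Equiv.swap (g i) (g' i) (g j)) := by
      show P.cands.image _ = _
      rw [h.cands, Finset.image_image]; rfl
    have h1 : Rlz Y b n (P.swapCands (g i) (g' i)) (fun j => Equiv.swap (g i) (g' i) (g j)) t := by
      refine ⟨(Equiv.injective _).comp h.inj, hc, ?_, ?_⟩
      · rw [hc]
        intro z hz
        obtain ⟨j, -, rfl⟩ := Finset.mem_image.mp hz
        have hj : g j ∈ Y := h.sub (by rw [h.cands]; simp)
        rw [Equiv.swap_apply_def]
        split_ifs <;> assumption
      · intro j l
        rw [beats_swap, Equiv.swap_apply_self, Equiv.swap_apply_self]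
        exact h.maj j l
    have hlt : (Finset.univ.filter
        (fun j => Equiv.swap (g i) (g' i) (g j) ≠ g' j)).card < k := by
      rw [← hk]
      apply Finset.card_lt_card
      rw [Finset.ssubset_iff_of_subset]
      · refine ⟨i, by simpa using hi, by simp⟩
      · intro j hj
        simp only [Finset.mem_filter, Finset.mem_univ, true_and] at hj ⊢
        intro hjj
        apply hj
        by_cases hji : j = i
        · subst hji; simp
        · rw [Equiv.swap_apply_of_ne_of_ne]
          · exact hjj
          · exact fun e => hji (h.inj e)
          · rw [hjj]; exact fun e => hji (h'.inj e)
    have h2 := ih _ hlt _ _ h1 rfl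
    intro j
    rw [← h2 j]
    have hw := hN P (by rw [hd]; exact h.sub) (g i) (g' i) (by rw [hd]; exact h1.sub)
    rw [hw]
    simp
  · push Not at hz
    have hg : g = g' := funext hz
    subst hg
    have : F.winners P = F.winners P' := by
      apply hM P (by rw [hd]; exact h.sub) P' (by rw [hd]; exact h'.sub)
      · rw [h.cands, h'.cands]
      · intro x hx y hy
        rw [h.cands] at hx hy
        obtain ⟨i, -, rfl⟩ := Finset.mem_image.mp hx
        obtain ⟨j, -, rfl⟩ := Finset.mem_image.mp hy
        cases b
        · have e1 := h.maj j i
          have e2 := h'.maj j i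
          simp only [Beats, Bool.false_eq_true, if_false] at e1 e2
          rw [e1, e2]
        · have e1 := h.maj i j
          have e2 := h'.maj i j
          simp only [Beats, if_true] at e1 e2
          rw [e1, e2]
    intro i
    rw [this]

theorem inv {Y : Finset C} {F : VotingMethod C V}
    (hd : F.dom = {P : Profile C V | P.cands ⊆ Y}) (hM : F.Majoritarian) (hN : F.Neutral)
    (b : Bool) {n : ℕ} {t : Fin n → Fin n → Bool} {P P' : Profile C V} {g g' : Fin n → C}
    (h : Rlz Y b n P g t) (h' : Rlz Y b n P' g' t) (i : Fin n) :
    g i ∈ F.winners P ↔ g' i ∈ F.winners P' :=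
  inv_aux hd hM hN b h' _ P g h rfl i

def t2 : Fin 2 → Fin 2 → Bool := fun i j => i.val < j.val

theorem margin_neg (P : Profile C V) (x y : C) : P.margin x y = - P.margin y x := by
  simp [Profile.margin]

theorem pair_cands (P : Profile C V) (x y : C) (hx : x ∈ P.cands) (hy : y ∈ P.cands) :
    (P.pair x y hx hy).cands = {x, y} := rfl

theorem pair_margin (P : Profile C V) (x y : C) (hx : x ∈ P.cands) (hy : y ∈ P.cands)
    {u v : C} (hu : u ∈ ({x, y} : Finset C)) (hv : v ∈ ({x, y} : Finset C)) :
    (P.pair x y hx hy).margin u v = P.margin u v :=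
  margin_restrict _ _ _ _ hu hv

theorem pair_rlz {Y : Finset C} (P : Profile C V) (hP : P.cands ⊆ Y) (x y : C)
    (hx : x ∈ P.cands) (hy : y ∈ P.cands) (hm : 0 < P.margin x y) :
    x ≠ y ∧ Rlz Y true 2 (P.pair x y hx hy) ![x, y] t2 := by
  have hne : x ≠ y := by
    rintro rfl
    simp [Profile.margin] at hm
  refine ⟨hne, ?_, ?_, ?_, ?_⟩
  · intro i j h
    fin_cases i <;> fin_cases j <;> simp_all
  · rw [pair_cands]; ext z; simp [Fin.exists_fin_two, eq_comm]
  · rw [pair_cands]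
    intro z hz
    simp only [Finset.mem_insert, Finset.mem_singleton] at hz
    rcases hz with rfl | rfl
    exacts [hP hx, hP hy]
  · have e0 : ∀ z, P.margin z z = 0 := fun z => by simp [Profile.margin]
    have e1 : ¬ 0 < P.margin y x := by
      rw [margin_neg]; omega
    intro i j
    fin_cases i <;> fin_cases j <;>
      simp [Beats, t2, pair_margin, e0, hm] <;> omega

theorem pair_win {Y : Finset C} {F : VotingMethod C V}
    (hd : F.dom = {P : Profile C V | P.cands ⊆ Y}) (hM : F.Majoritarian) (hN : F.Neutral)
    (hQ : F.BinaryQuasiResolute) :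
    ∃ b : Bool, ∀ P : Profile C V, P.cands ⊆ Y → ∀ x y, ∀ (hx : x ∈ P.cands) (hy : y ∈ P.cands),
      Beats b P x y → F.winners (P.pair x y hx hy) = {x} := by
  have key : ∀ P : Profile C V, P.cands ⊆ Y → ∀ x y, ∀ (hx : x ∈ P.cands) (hy : y ∈ P.cands),
      0 < P.margin x y → F.winners (P.pair x y hx hy) = {x} ∨
        F.winners (P.pair x y hx hy) = {y} := by
    intro P hP x y hx hy hm
    obtain ⟨hne, hr⟩ := pair_rlz P hP x y hx hy hm
    have hdom : P.pair x y hx hy ∈ F.dom := by rw [hd]; exact hr.sub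
    have hc : (F.winners (P.pair x y hx hy)).card = 1 := by
      apply hQ _ hdom
      · rw [pair_cands, Finset.card_pair hne]
      · intro u hu v hv huv
        rw [pair_cands] at hu hv
        rw [pair_margin _ _ _ _ _ hu hv]
        simp only [Finset.mem_insert, Finset.mem_singleton] at hu hv
        have := margin_neg P x y
        rcases hu with rfl | rfl <;> rcases hv with rfl | rfl <;> first | omega | simp at huv
    obtain ⟨z, hz⟩ := Finset.card_eq_one.mp hc
    have hzz := F.winners_sub _ hdom
    rw [hz, pair_cands] at hzz
    have : z ∈ ({x, y} : Finset C) := hzz (by simp)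
    simp only [Finset.mem_insert, Finset.mem_singleton] at this
    rcases this with rfl | rfl
    · exact Or.inl hz
    · exact Or.inr hz
  by_cases hex : ∃ (P : Profile C V) (_ : P.cands ⊆ Y) (x y : C) (hx : x ∈ P.cands)
      (hy : y ∈ P.cands), 0 < P.margin x y ∧ F.winners (P.pair x y hx hy) = {x}
  · obtain ⟨P0, hP0, x0, y0, hx0, hy0, hm0, hw0⟩ := hex
    refine ⟨true, ?_⟩
    intro P hP x y hx hy hb
    have hm : 0 < P.margin x y := by simpa [Beats] using hb
    obtain ⟨hne, hr⟩ := pair_rlz P hP x y hx hy hm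
    obtain ⟨hne0, hr0⟩ := pair_rlz P0 hP0 x0 y0 hx0 hy0 hm0
    have := (inv hd hM hN true hr hr0 0).mpr (by simp [hw0])
    rcases key P hP x y hx hy hm with h | h
    · exact h
    · rw [h] at this
      simp at this
      exact absurd this hne
  · push Not at hex
    refine ⟨false, ?_⟩
    intro P hP x y hx hy hb
    have hm : 0 < P.margin y x := by simpa [Beats] using hb
    have e : P.pair x y hx hy = P.pair y x hy hx := by
      simp only [Profile.pair, Finset.pair_comm]
    rw [e]
    rcases key P hP y x hy hx hm with h | h
    · exact absurd h (hex P hP y x hy hx hm)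
    · exact h

/-- The abstract choice function on patterns. -/
def f (F : VotingMethod C V) (Y : Finset C) (b : Bool) (n : ℕ) (t : Fin n → Fin n → Bool) :
    Finset (Fin n) :=
  if h : ∃ (P : Profile C V) (g : Fin n → C), Rlz Y b n P g t then
    Finset.univ.filter (fun i => h.choose_spec.choose i ∈ F.winners h.choose)
  else ∅

def Ex (V : Type) {C : Type} (Y : Finset C) (b : Bool) (n : ℕ) (t : Fin n → Fin n → Bool) : Prop :=
  ∃ (P : Profile C V) (g : Fin n → C), Rlz Y b n P g t

theorem mem_f {Y : Finset C} {F : VotingMethod C V}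
    (hd : F.dom = {P : Profile C V | P.cands ⊆ Y}) (hM : F.Majoritarian) (hN : F.Neutral)
    {b : Bool} {n : ℕ} {t : Fin n → Fin n → Bool} {P : Profile C V} {g : Fin n → C}
    (h : Rlz Y b n P g t) (i : Fin n) : i ∈ f F Y b n t ↔ g i ∈ F.winners P := by
  have hex : ∃ (P : Profile C V) (g : Fin n → C), Rlz Y b n P g t := ⟨P, g, h⟩
  unfold f
  rw [dif_pos hex]
  simp only [Finset.mem_filter, Finset.mem_univ, true_and]
  exact inv hd hM hN b hex.choose_spec.choose_spec h i

theorem win_eq {Y : Finset C} {F : VotingMethod C V}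
    (hd : F.dom = {P : Profile C V | P.cands ⊆ Y}) (hM : F.Majoritarian) (hN : F.Neutral)
    {b : Bool} {n : ℕ} {t : Fin n → Fin n → Bool} {P : Profile C V} {g : Fin n → C}
    (h : Rlz Y b n P g t) : F.winners P = (f F Y b n t).image g := by
  ext z
  rw [Finset.mem_image]
  constructor
  · intro hz
    have hz' := F.winners_sub P (by rw [hd]; exact h.sub) hz
    rw [h.cands] at hz'
    obtain ⟨i, -, rfl⟩ := Finset.mem_image.mp hz'
    exact ⟨i, (mem_f hd hM hN h i).mpr hz, rfl⟩
  · rintro ⟨i, hi, rfl⟩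
    exact (mem_f hd hM hN h i).mp hi

theorem card_f {Y : Finset C} {F : VotingMethod C V}
    (hd : F.dom = {P : Profile C V | P.cands ⊆ Y}) (hM : F.Majoritarian) (hN : F.Neutral)
    {b : Bool} {n : ℕ} {t : Fin n → Fin n → Bool} {P : Profile C V} {g : Fin n → C}
    (h : Rlz Y b n P g t) : (F.winners P).card = (f F Y b n t).card := by
  rw [win_eq hd hM hN h, Finset.card_image_of_injective _ h.inj]

theorem f_nonempty {Y : Finset C} {F : VotingMethod C V}
    (hd : F.dom = {P : Profile C V | P.cands ⊆ Y}) (hM : F.Majoritarian) (hN : F.Neutral)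
    {b : Bool} {n : ℕ} {t : Fin n → Fin n → Bool} (h : Ex V Y b n t) :
    (f F Y b n t).Nonempty := by
  obtain ⟨P, g, h⟩ := h
  have := F.winners_nonempty P (by rw [hd]; exact h.sub)
  rw [win_eq hd hM hN h] at this
  exact Finset.image_nonempty.mp this

theorem f_auto {Y : Finset C} {F : VotingMethod C V}
    (hd : F.dom = {P : Profile C V | P.cands ⊆ Y}) (hM : F.Majoritarian) (hN : F.Neutral)
    {b : Bool} {n : ℕ} {t : Fin n → Fin n → Bool} (h : Ex V Y b n t) (σ : Fin n → Fin n)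
    (hσ : Function.Injective σ) (ht : ∀ i j, t (σ i) (σ j) = t i j) (i : Fin n) :
    i ∈ f F Y b n t ↔ σ i ∈ f F Y b n t := by
  obtain ⟨P, g, h⟩ := h
  have h2 : Rlz Y b n P (g ∘ σ) t := by
    refine ⟨h.inj.comp hσ, ?_, h.sub, fun i j => ?_⟩
    · rw [h.cands, ← Finset.image_image, Finset.image_univ_of_surjective
        (Finite.injective_iff_surjective.mp hσ)]
    · rw [← ht]; exact h.maj _ _
  exact (mem_f hd hM hN h2 i).trans (mem_f hd hM hN h (σ i)).symm

theorem erase_image {n : ℕ} {g : Fin (n+1) → C} (hg : Function.Injective g)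
    {m : Fin n → Fin (n+1)} (hm : Function.Injective m) {y : Fin (n+1)} (hy : ∀ i, m i ≠ y) :
    (Finset.univ.image g).erase (g y) = Finset.univ.image (g ∘ m) := by
  have e : Finset.univ.image m = Finset.univ.erase y := by
    apply Finset.eq_of_subset_of_card_le
    · intro z hz
      obtain ⟨j, -, rfl⟩ := Finset.mem_image.mp hz
      simp [hy j]
    · rw [Finset.card_image_of_injective _ hm]
      simp
  rw [← Finset.image_image, e]
  ext z
  simp only [Finset.mem_erase, Finset.mem_image, Finset.mem_univ, true_and, and_true]
  constructor
  · rintro ⟨h1, a, rfl⟩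
    exact ⟨a, fun e => h1 (by rw [e]), rfl⟩
  · rintro ⟨a, h1, rfl⟩
    exact ⟨fun e => h1 (hg e), a, rfl⟩

theorem minus_rlz {Y : Finset C} {b : Bool} {n : ℕ} {t : Fin (n+1) → Fin (n+1) → Bool}
    {t' : Fin n → Fin n → Bool} {P : Profile C V} {g : Fin (n+1) → C} (h : Rlz Y b (n+1) P g t)
    (hn : 0 < n) (m : Fin n → Fin (n+1)) (y : Fin (n+1))
    (hm : Function.Injective m) (hy : ∀ i, m i ≠ y)
    (ht : ∀ i j, t (m i) (m j) = t' i j) :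
    ∃ hne : (P.cands.erase (g y)).Nonempty, Rlz Y b n (P.minus (g y) hne) (g ∘ m) t' := by
  have e : P.cands.erase (g y) = Finset.univ.image (g ∘ m) := by
    rw [h.cands, erase_image h.inj hm hy]
  have hne : (P.cands.erase (g y)).Nonempty := by
    rw [e]
    exact ⟨_, Finset.mem_image_of_mem _ (Finset.mem_univ (⟨0, hn⟩ : Fin n))⟩
  refine ⟨hne, h.inj.comp hm, e, (Finset.erase_subset _ _).trans h.sub, fun i j => ?_⟩
  rw [← ht, ← h.maj]
  apply beats_restrict
  · rw [e]; exact Finset.mem_image_of_mem _ (Finset.mem_univ _)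
  · rw [e]; exact Finset.mem_image_of_mem _ (Finset.mem_univ _)

theorem ex_sub {Y : Finset C} {b : Bool} {n : ℕ} {t : Fin (n+1) → Fin (n+1) → Bool}
    {t' : Fin n → Fin n → Bool} (h : Ex V Y b (n+1) t)
    (hn : 0 < n) (m : Fin n → Fin (n+1)) (y : Fin (n+1))
    (hm : Function.Injective m) (hy : ∀ i, m i ≠ y)
    (ht : ∀ i j, t (m i) (m j) = t' i j) : Ex V Y b n t' := by
  obtain ⟨P, g, h⟩ := h
  obtain ⟨_, h2⟩ := minus_rlz h hn m y hm hy ht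
  exact ⟨_, _, h2⟩

/-- The properties of the abstract choice function. -/
structure Abs (E : (n : ℕ) → (Fin n → Fin n → Bool) → Prop)
    (f : (n : ℕ) → (Fin n → Fin n → Bool) → Finset (Fin n)) : Prop where
  ne : ∀ {n t}, E n t → (f n t).Nonempty
  auto : ∀ {n t}, E n t → ∀ σ : Fin n → Fin n, Function.Injective σ →
    (∀ i j, t (σ i) (σ j) = t i j) → ∀ i, i ∈ f n t ↔ σ i ∈ f n t
  sub : ∀ {n t t'}, E (n+1) t → 0 < n → ∀ (m : Fin n → Fin (n+1)) (y : Fin (n+1)),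
    (Function.Injective m ∧ (∀ i, m i ≠ y) ∧ ∀ i j, t (m i) (m j) = t' i j) → E n t'
  step : ∀ {n t t'}, E (n+1) t → 0 < n → ∀ (m : Fin n → Fin (n+1)) (y : Fin (n+1)),
    (Function.Injective m ∧ (∀ i, m i ≠ y) ∧ ∀ i j, t (m i) (m j) = t' i j) →
    ∀ x, x ∈ f n t' → t (m x) y = true →
      m x ∈ f (n+1) t ∧ (f (n+1) t).card ≤ (f n t').card

theorem abs_of {Y : Finset C} {F : VotingMethod C V}
    (hd : F.dom = {P : Profile C V | P.cands ⊆ Y}) (hM : F.Majoritarian) (hN : F.Neutral)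
    (hG : F.BinaryGamma) (hA : F.AlphaResolute) (b : Bool)
    (hb : ∀ P : Profile C V, P.cands ⊆ Y → ∀ x y, ∀ (hx : x ∈ P.cands) (hy : y ∈ P.cands),
      Beats b P x y → F.winners (P.pair x y hx hy) = {x}) :
    Abs (fun n t => Ex V Y b n t) (fun n t => f F Y b n t) := by
  refine ⟨f_nonempty hd hM hN, f_auto hd hM hN,
    fun h hn m y hh => ex_sub h hn m y hh.1 hh.2.1 hh.2.2, ?_⟩
  rintro n t t' ⟨P, g, h⟩ hn m y ⟨hm, hy, ht⟩ x hx htx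
  obtain ⟨hne, h2⟩ := minus_rlz h hn m y hm hy ht
  have hxc : g (m x) ∈ P.cands := by rw [h.cands]; simp
  have hyc : g y ∈ P.cands := by rw [h.cands]; simp
  have hxy : g (m x) ≠ g y := fun e => hy x (h.inj e)
  have hP : P ∈ F.dom := by rw [hd]; exact h.sub
  have h2d : P.minus (g y) hne ∈ F.dom := by rw [hd]; exact h2.sub
  have hpd : P.pair (g (m x)) (g y) hxc hyc ∈ F.dom := by
    rw [hd]
    intro z hz
    rw [pair_cands] at hz
    simp only [Finset.mem_insert, Finset.mem_singleton] at hz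
    rcases hz with rfl | rfl
    exacts [h.sub hxc, h.sub hyc]
  have hw := hb P h.sub _ _ hxc hyc ((h.maj _ _).mpr htx)
  have hxw := (mem_f hd hM hN h2 x).mp hx
  refine ⟨(mem_f hd hM hN h _).mpr (hG P hP _ hxc _ hyc hxy hne h2d hpd hxw hw), ?_⟩
  rw [← card_f hd hM hN h, ← card_f hd hM hN h2]
  exact hA P hP _ hxc _ hyc hxy hne h2d hpd hxw hw

/-- The tournament on `Fin n` given by lists of out-neighbours. -/
def T3 : Fin 3 → Fin 3 → Bool := ![![false, true, false], ![false, false, true],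
  ![true, false, false]]
def T4 : Fin 4 → Fin 4 → Bool := ![![false, true, true, false], ![false, false, true, true],
  ![false, false, false, true], ![true, false, false, false]]
def T5 : Fin 5 → Fin 5 → Bool := ![![false, true, true, false, false],
  ![false, false, true, true, false], ![false, false, false, true, true],
  ![true, false, false, false, true], ![true, true, false, false, false]]
def T5a : Fin 5 → Fin 5 → Bool := ![![false, true, true, true, false],
  ![false, false, true, true, false], ![false, false, false, true, true],
  ![false, false, false, false, true], ![true, true, false, false, false]]
def T5b : Fin 5 → Fin 5 → Bool := ![![false, true, true, true, false],
  ![false, false, true, true, true], ![false, false, false, true, true],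
  ![false, false, false, false, true], ![true, false, false, false, false]]
def T6a : Fin 6 → Fin 6 → Bool := ![![false, true, true, true, false, false],
  ![false, false, true, true, true, false], ![false, false, false, true, true, true],
  ![false, false, false, false, true, true], ![true, false, false, false, false, true],
  ![true, true, false, false, false, false]]
def T6b : Fin 6 → Fin 6 → Bool := ![![false, true, true, true, true, false],
  ![false, false, true, true, true, true], ![false, false, false, true, true, false],
  ![false, false, false, false, true, true], ![false, false, false, false, false, true],
  ![true, false, true, false, false, false]]

theorem core {E : (n : ℕ) → (Fin n → Fin n → Bool) → Prop}
    {f : (n : ℕ) → (Fin n → Fin n → Bool) → Finset (Fin n)} (H : Abs E f)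
    (ha : E 6 T6a) (hb : E 6 T6b) : False := by
  have e5 : E 5 T5 := H.sub ha (by decide) ![0, 1, 3, 4, 5] 2 (by decide)
  have e5a : E 5 T5a := H.sub ha (by decide) ![0, 1, 2, 3, 5] 4 (by decide)
  have e5b : E 5 T5b := H.sub hb (by decide) ![0, 1, 3, 4, 5] 2 (by decide)
  have e4 : E 4 T4 := H.sub e5a (by decide) ![1, 2, 3, 4] 0 (by decide)
  have e3 : E 3 T3 := H.sub e4 (by decide) ![0, 1, 3] 2 (by decide)
  have f3 : ∀ i, i ∈ f 3 T3 := by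
    have h := H.auto e3 ![1, 2, 0] (by decide) (by decide)
    obtain ⟨i, hi⟩ := H.ne e3
    have h0 := h 0
    have h1 := h 1
    have h2 := h 2
    simp only [Matrix.cons_val] at h0 h1 h2
    intro j
    clear h
    fin_cases i <;> fin_cases j <;> simp only [Fin.zero_eta, Fin.mk_one, Fin.reduceFinMk] at hi ⊢ <;> tauto
  have f5 : ∀ i, i ∈ f 5 T5 := by
    have h := H.auto e5 ![1, 2, 3, 4, 0] (by decide) (by decide)
    obtain ⟨i, hi⟩ := H.ne e5
    have h0 := h 0
    have h1 := h 1
    have h2 := h 2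
    have h3 := h 3
    have h4 := h 4
    simp only [Matrix.cons_val] at h0 h1 h2 h3 h4
    intro j
    clear h
    fin_cases i <;> fin_cases j <;> simp only [Fin.zero_eta, Fin.mk_one, Fin.reduceFinMk] at hi ⊢ <;> tauto
  have c5 : (f 5 T5).card = 5 := by
    rw [Finset.eq_univ_of_forall f5]; rfl
  have c4 : (f 4 T4).card ≤ 4 := card_finset_fin_le _
  have n42 : (2 : Fin 4) ∉ f 4 T4 := by
    intro h
    have : (f 5 T5).card ≤ (f 4 T4).card := (H.step e5 (by decide) ![0, 1, 2, 3] 4 (by decide) 2 h (by decide)).2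
    omega
  have n43 : (3 : Fin 4) ∉ f 4 T4 := by
    intro h
    have : (f 5 T5).card ≤ (f 4 T4).card := (H.step e5 (by decide) ![0, 1, 2, 3] 4 (by decide) 3 h (by decide)).2
    omega
  have m40 : (0 : Fin 4) ∈ f 4 T4 :=
    (H.step e4 (by decide) ![0, 1, 3] 2 (by decide) 0 (f3 0) (by decide)).1
  have m41 : (1 : Fin 4) ∈ f 4 T4 :=
    (H.step e4 (by decide) ![0, 1, 3] 2 (by decide) 1 (f3 1) (by decide)).1
  have c4' : (f 4 T4).card ≤ 2 := by
    have : f 4 T4 ⊆ {0, 1} := by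
      intro i hi
      fin_cases i <;> simp_all
    exact (Finset.card_le_card this).trans (by decide)
  have c5a : (f 5 T5a).card ≤ 2 :=
    (H.step e5a (by decide) ![4, 0, 1, 2] 3 (by decide) 1 m41 (by decide)).2.trans c4'
  have m5b0 : (0 : Fin 5) ∈ f 5 T5b :=
    (H.step e5b (by decide) ![0, 1, 3, 4] 2 (by decide) 0 m40 (by decide)).1
  have m5b1 : (1 : Fin 5) ∈ f 5 T5b :=
    (H.step e5b (by decide) ![0, 1, 3, 4] 2 (by decide) 1 m41 (by decide)).1
  have a0 : (0 : Fin 6) ∈ f 6 T6a :=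
    (H.step ha (by decide) ![0, 1, 3, 4, 5] 2 (by decide) 0 (f5 0) (by decide)).1
  have a1 : (1 : Fin 6) ∈ f 6 T6a :=
    (H.step ha (by decide) ![0, 1, 3, 4, 5] 2 (by decide) 1 (f5 1) (by decide)).1
  have a2 : (2 : Fin 6) ∈ f 6 T6a :=
    (H.step ha (by decide) ![0, 1, 2, 4, 5] 3 (by decide) 2 (f5 2) (by decide)).1
  have c6 : 3 ≤ (f 6 T6a).card := by
    have : ({0, 1, 2} : Finset (Fin 6)) ⊆ f 6 T6a := by
      intro i hi
      simp only [Finset.mem_insert, Finset.mem_singleton] at hi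
      rcases hi with rfl | rfl | rfl <;> assumption
    exact le_trans (by decide) (Finset.card_le_card this)
  have n1 : (1 : Fin 5) ∉ f 5 T5a := by
    intro h
    have : (f 6 T6a).card ≤ (f 5 T5a).card := (H.step ha (by decide) ![0, 1, 2, 3, 5] 4 (by decide) 1 h (by decide)).2
    omega
  have n2 : (2 : Fin 5) ∉ f 5 T5a := by
    intro h
    have : (f 6 T6a).card ≤ (f 5 T5a).card := (H.step ha (by decide) ![0, 1, 2, 3, 5] 4 (by decide) 2 h (by decide)).2
    omega
  have n3 : (3 : Fin 5) ∉ f 5 T5a := by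
    intro h
    have : (f 6 T6a).card ≤ (f 5 T5a).card := (H.step ha (by decide) ![0, 1, 2, 3, 5] 4 (by decide) 3 h (by decide)).2
    omega
  have n4 : (4 : Fin 5) ∉ f 5 T5a := by
    intro h
    have : (f 6 T6a).card ≤ (f 5 T5a).card := (H.step ha (by decide) ![2, 3, 4, 5, 0] 1 (by decide) 4 h (by decide)).2
    omega
  have s5a : f 5 T5a ⊆ {0} := by
    intro i hi
    fin_cases i <;> simp_all
  have m5a : (0 : Fin 5) ∈ f 5 T5a := by
    obtain ⟨i, hi⟩ := H.ne e5a
    have := s5a hi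
    simp only [Finset.mem_singleton] at this
    rwa [this] at hi
  have b0 := (H.step hb (by decide) ![0, 1, 3, 4, 5] 2 (by decide) 0 m5b0 (by decide)).1
  have b1 := (H.step hb (by decide) ![0, 1, 3, 4, 5] 2 (by decide) 1 m5b1 (by decide)).1
  have cb := (H.step hb (by decide) ![0, 2, 3, 4, 5] 1 (by decide) 0 m5a (by decide)).2
  have c1 : (f 5 T5a).card ≤ 1 := (Finset.card_le_card s5a).trans (by decide)
  have := Finset.card_le_one.mp (cb.trans c1) _ b0 _ b1
  revert this
  decide

/-- Profile with three voters given by positions. -/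
def mk (v : ℕ ↪ V) (g : Fin 6 → C) (hg : Function.Injective g) (p : Fin 3 → Fin 6 → Fin 6)
    (hp : ∀ k, Function.Injective (p k)) : Profile C V where
  voters := Finset.univ.image (fun k : Fin 3 => v k)
  cands := Finset.univ.image g
  cands_nonempty := ⟨g 0, by simp⟩
  ballot := fun i x y => ∃ k : Fin 3, v k = i ∧ ∃ a b, g a = x ∧ g b = y ∧ p k a < p k b
  ballot_lin := by
    intro i _
    obtain ⟨k, -, rfl⟩ := Finset.mem_image.mp ‹_›
    have hv : ∀ l : Fin 3, v l = v k → l = k := fun l h => Fin.ext (v.injective h)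
    refine ⟨?_, ?_, ?_, ?_⟩
    · rintro x ⟨l, hl, a, b, rfl, h, hlt⟩
      rw [hg h] at hlt
      exact lt_irrefl _ hlt
    · rintro x y z ⟨l, hl, a, b, rfl, rfl, h1⟩ ⟨l', hl', a', b', h, rfl, h2⟩
      obtain rfl := hv l hl
      obtain rfl := hv l' hl'
      rw [hg h] at h2
      exact ⟨_, rfl, a, b', rfl, rfl, h1.trans h2⟩
    · intro x hx y hy hne
      obtain ⟨a, -, rfl⟩ := Finset.mem_image.mp hx
      obtain ⟨b, -, rfl⟩ := Finset.mem_image.mp hy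
      have : p k a ≠ p k b := fun e => hne (by rw [hp k e])
      rcases lt_or_gt_of_ne this with h | h
      · exact Or.inl ⟨k, rfl, a, b, rfl, rfl, h⟩
      · exact Or.inr ⟨k, rfl, b, a, rfl, rfl, h⟩
    · rintro x y ⟨l, hl, a, b, rfl, rfl, h1⟩
      simp

theorem mk_margin (v : ℕ ↪ V) (g : Fin 6 → C) (hg : Function.Injective g)
    (p : Fin 3 → Fin 6 → Fin 6) (hp : ∀ k, Function.Injective (p k)) (a b : Fin 6) :
    (mk v g hg p hp).margin (g a) (g b) =
      ((List.finRange 3).countP (fun k => decide (p k a < p k b)) : ℤ) -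
      ((List.finRange 3).countP (fun k => decide (p k b < p k a)) : ℤ) := by
  have key : ∀ a b : Fin 6,
      ((mk v g hg p hp).voters.filter (fun i => (mk v g hg p hp).ballot i (g a) (g b))).card =
      (List.finRange 3).countP (fun k => decide (p k a < p k b)) := by
    intro a b
    have hinj : Function.Injective (fun k : Fin 3 => v k) :=
      fun k l h => Fin.ext (v.injective h)
    have : (mk v g hg p hp).voters.filter (fun i => (mk v g hg p hp).ballot i (g a) (g b)) =
        (Finset.univ.filter (fun k : Fin 3 => p k a < p k b)).image (fun k : Fin 3 => v k) := by
      ext i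
      rw [Finset.mem_filter, Finset.mem_image]
      constructor
      · rintro ⟨-, k, hk, a', b', ha, hb, h⟩
        rw [hg ha, hg hb] at h
        exact ⟨k, Finset.mem_filter.mpr ⟨Finset.mem_univ _, h⟩, hk⟩
      · rintro ⟨k, h, rfl⟩
        exact ⟨Finset.mem_image_of_mem _ (Finset.mem_univ k), k, rfl, a, b, rfl, rfl,
          (Finset.mem_filter.mp h).2⟩
    rw [this, Finset.card_image_of_injective _ hinj]
    rw [Finset.card_filter, Fin.sum_univ_three]
    simp only [List.finRange_succ, List.finRange_zero, List.map_cons, List.map_nil,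
      List.countP_cons, List.countP_nil, decide_eq_true_eq]
    simp only [Fin.succ_zero_eq_one, Fin.succ_one_eq_two]
    omega
  rw [Profile.margin, key, key]

theorem ex_mk [Infinite V] {Y : Finset C} (g : Fin 6 → C) (hg : Function.Injective g)
    (hY : ∀ i, g i ∈ Y) (t : Fin 6 → Fin 6 → Bool) (b : Bool)
    (p : Fin 3 → Fin 6 → Fin 6) (hp : ∀ k, Function.Injective (p k))
    (h : ∀ i j, (decide (0 < ((List.finRange 3).countP (fun k => decide (p k i < p k j)) : ℤ) -
      ((List.finRange 3).countP (fun k => decide (p k j < p k i)) : ℤ))) = t i j) :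
    Ex V Y b 6 t := by
  have v : ℕ ↪ V := Infinite.natEmbedding V
  cases b
  · have hr : ∀ k, Function.Injective (fun i => Fin.rev (p k i)) :=
      fun k => Fin.rev_injective.comp (hp k)
    refine ⟨mk v g hg (fun k i => Fin.rev (p k i)) hr, g, hg, rfl, ?_, ?_⟩
    · intro z hz
      obtain ⟨j, -, rfl⟩ := Finset.mem_image.mp hz
      exact hY j
    · intro i j
      rw [← h i j, decide_eq_true_iff]
      simp only [Beats, Bool.false_eq_true, if_false]
      rw [mk_margin]
      simp only [Fin.rev_lt_rev]
  · refine ⟨mk v g hg p hp, g, hg, rfl, ?_, ?_⟩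
    · intro z hz
      obtain ⟨j, -, rfl⟩ := Finset.mem_image.mp hz
      exact hY j
    · intro i j
      rw [← h i j, decide_eq_true_iff]
      simp only [Beats, if_true]
      rw [mk_margin]

end NM

/-- For any finite set `Y` of candidates with `|Y| ≥ 6`, there is no
majoritarian voting method with domain `{P : X(P) ⊆ Y}` satisfying anonymity,
neutrality, binary quasi-resoluteness, binary γ, and α-resoluteness. -/
theorem no_majoritarian_method (C V : Type) [Infinite C] [Infinite V]
    (Y : Finset C) (hY : 6 ≤ Y.card) :
    ¬ ∃ F : VotingMethod C V,
      F.dom = {P : Profile C V | P.cands ⊆ Y} ∧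
      F.Majoritarian ∧ F.Anonymous ∧ F.Neutral ∧ F.BinaryQuasiResolute ∧
      F.BinaryGamma ∧ F.AlphaResolute := by
  rintro ⟨F, hd, hM, -, hN, hQ, hG, hA⟩
  obtain ⟨b, hb⟩ := NM.pair_win hd hM hN hQ
  obtain ⟨S, hS, hc⟩ := Finset.exists_subset_card_eq hY
  let e := S.equivFinOfCardEq hc
  have hg : Function.Injective (fun i : Fin 6 => ((e.symm i : S) : C)) :=
    Subtype.val_injective.comp e.symm.injective
  have hgY : ∀ i : Fin 6, ((e.symm i : S) : C) ∈ Y := fun i => hS (e.symm i).2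
  refine NM.core (NM.abs_of hd hM hN hG hA b hb) ?_ ?_
  · exact NM.ex_mk _ hg hgY NM.T6a b
      ![![0, 1, 2, 3, 4, 5], ![2, 3, 4, 5, 0, 1], ![5, 3, 0, 1, 4, 2]] (by decide) (by decide)
  · exact NM.ex_mk _ hg hgY NM.T6b b
      ![![0, 1, 2, 3, 4, 5], ![1, 2, 3, 4, 5, 0], ![4, 0, 5, 1, 2, 3]] (by decide) (by decide)
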